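/- arXiv:2106.15780 — 3 statements merged into one kernel-verified Lean document; each statement's English description precedes it below -/
import Mathlib

section
/- Let ≺ be a transitive relation on ℕ, let I be an ideal with respect to ≺_V, and let r ∈ I. Then there exists a compact saturated subset K of the space of ideals I(≺) such that: (i) K ⊆ ⋃_{b∈dom(r)} [b]_≺; and (ii) for any finite F ⊆ ℕ, if K ⊆ ⋃_{b∈F} [b]_≺ then there is s ∈ I with r ≺_V s, F ≺_U dom(s), and K ⊆ ⋃_{c∈dom(s)} [c]_≺ ⊆ ⋃_{b∈F} [b]_≺. -/
open TopologicalSpace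
open scoped Classical NNRat NNReal ENNReal

/-- An ideal with respect to a (transitive) relation: a nonempty, lower, directed subset. -/
def IsIdeal {α : Type*} (prec : α → α → Prop) (I : Set α) : Prop :=
  I.Nonempty ∧ (∀ a ∈ I, ∀ b, prec b a → b ∈ I) ∧
    ∀ a ∈ I, ∀ b ∈ I, ∃ c ∈ I, prec a c ∧ prec b c

/-- The space of ideals of a relation. -/
def IdealSpace {α : Type*} (prec : α → α → Prop) : Type _ := {I : Set α // IsIdeal prec I}

/-- The basic open set `[n]_≺ = {I ∈ I(≺) : n ∈ I}`. -/
def basicOpen {α : Type*} (prec : α → α → Prop) (n : α) : Set (IdealSpace prec) :=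
  {I | n ∈ I.1}

/-- The topology on the space of ideals, generated by the basic open sets. -/
instance {α : Type*} (prec : α → α → Prop) : TopologicalSpace (IdealSpace prec) :=
  TopologicalSpace.generateFrom {U | ∃ n, U = basicOpen prec n}

theorem isOpen_basicOpen {α : Type*} (prec : α → α → Prop) (n : α) :
    IsOpen (basicOpen prec n) :=
  TopologicalSpace.isOpen_generateFrom_of_mem ⟨n, rfl⟩

/-- `[n]_≺` as an element of the open-set lattice. -/
def basicOpens {α : Type*} (prec : α → α → Prop) (n : α) : Opens (IdealSpace prec) :=
  ⟨basicOpen prec n, isOpen_basicOpen prec n⟩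

/-- The relation `≺_V` on the set `B` of partial functions from `ℕ` to the positive
rationals with finite domain (modelled as finitely supported functions `ℕ →₀ ℚ≥0`,
with domain the support):  `r ≺_V s` iff for every nonempty `F ⊆ dom r`,
`∑_{b ∈ F} r b < ∑_{c ∈ ↑F ∩ dom s} s c`, where `↑F = {c | ∃ b ∈ F, b ≺ c}`. -/
def precV (prec : ℕ → ℕ → Prop) (r s : ℕ →₀ ℚ≥0) : Prop :=
  ∀ F : Finset ℕ, F.Nonempty → F ⊆ r.support →
    ∑ b ∈ F, r b < ∑ c ∈ s.support.filter (fun c => ∃ b ∈ F, prec b c), s c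

/-- The relation `≺_U` on finite subsets of `ℕ`. -/
def precU (prec : ℕ → ℕ → Prop) (F G : Finset ℕ) : Prop :=
  ∀ n ∈ G, ∃ m ∈ F, prec m n

/-- A (Scott-continuous) valuation on a topological space: a Scott-continuous, strict,
modular function from the open-set lattice to `[0,∞]`. -/
structure Valuation' (X : Type*) [TopologicalSpace X] where
  toFun : Opens X → ℝ≥0∞
  scott' : ScottContinuous toFun
  strict' : toFun ⊥ = 0
  modular' : ∀ U V : Opens X, toFun U + toFun V = toFun (U ⊔ V) + toFun (U ⊓ V)

/-- The weak topology on the space of valuations, generated by the subbasic opens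
`⟨U, q⟩ = {ν | ν U > q}` for `U` open and `q < ∞`. -/
instance {X : Type*} [TopologicalSpace X] : TopologicalSpace (Valuation' X) :=
  TopologicalSpace.generateFrom
    {S | ∃ (U : Opens X) (q : ℝ≥0∞), q ≠ ⊤ ∧ S = {ν : Valuation' X | q < ν.toFun U}}

/-- The union `⋃_{b ∈ F} [b]_≺` as an open set. -/
def unionOpens (prec : ℕ → ℕ → Prop) (F : Finset ℕ) : Opens (IdealSpace prec) :=
  ⟨⋃ b ∈ F, basicOpen prec b, isOpen_biUnion fun b _ => isOpen_basicOpen prec b⟩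

/-- The set `f_V(ν) = {r ∈ B | ∑_{b∈F} r b < ν (⋃_{b∈F} [b]_≺) for every nonempty F ⊆ dom r}`. -/
def fVset (prec : ℕ → ℕ → Prop) (ν : Valuation' (IdealSpace prec)) : Set (ℕ →₀ ℚ≥0) :=
  {r | ∀ F : Finset ℕ, F.Nonempty → F ⊆ r.support →
    (∑ b ∈ F, ((r b : ℝ≥0) : ℝ≥0∞)) < ν.toFun (unionOpens prec F)}

/-- The function `g_V(I) = λ U. ⨆ {∑_{b ∈ dom r} r b | r ∈ I and ⋃_{b ∈ dom r} [b]_≺ ⊆ U}`. -/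
noncomputable def gVfun (prec : ℕ → ℕ → Prop) (I : Set (ℕ →₀ ℚ≥0))
    (U : Opens (IdealSpace prec)) : ℝ≥0∞ :=
  ⨆ r ∈ {r : ℕ →₀ ℚ≥0 | r ∈ I ∧ unionOpens prec r.support ≤ U},
    ∑ b ∈ r.support, ((r b : ℝ≥0) : ℝ≥0∞)

/-- The set `g_U(J) = {I ∈ I(≺) | ∀ F ∈ J, ∃ m ∈ I, m ∈ F}`. -/
def gUset (prec : ℕ → ℕ → Prop) (J : Set (Finset ℕ)) : Set (IdealSpace prec) :=
  {I | ∀ F ∈ J, ∃ m ∈ I.1, m ∈ F}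

/-- Pigeonhole: a decreasing sequence of predicates on a finite set, each satisfied somewhere,
has a common witness. -/
theorem exists_mem_forall_of_antitone {α : Type*} (S : Finset α) (Q : ℕ → α → Prop)
    (hQ : ∀ k l, k ≤ l → ∀ d, Q l d → Q k d) (h : ∀ k, ∃ d ∈ S, Q k d) :
    ∃ d ∈ S, ∀ k, Q k d := by
  by_contra! hcon
  choose! g hg using hcon
  obtain ⟨d, hd, hQd⟩ := h (S.sup g)
  exact hg d hd (hQ _ _ (Finset.le_sup hd) _ hQd)

/-- `c` starts an ascending chain of length `k` through the levels `n, n + 1, …, n + k`. -/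
def HasChain {α : Type*} (prec : α → α → Prop) (D : ℕ → Finset α) : ℕ → ℕ → α → Prop
  | 0, n, c => c ∈ D n
  | k + 1, n, c => c ∈ D n ∧ ∃ d, prec c d ∧ HasChain prec D k (n + 1) d

section HasChain

variable {α : Type*} {prec : α → α → Prop} {D : ℕ → Finset α}

theorem HasChain.mem {k n : ℕ} {c : α} (h : HasChain prec D k n c) : c ∈ D n := by
  cases k with
  | zero => exact h
  | succ k => exact h.1

theorem HasChain.of_succ {k n : ℕ} {c : α} (h : HasChain prec D (k + 1) n c) :
    HasChain prec D k n c := by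
  induction k generalizing n c with
  | zero => exact h.1
  | succ k ih =>
    obtain ⟨hc, d, hcd, hd⟩ := h
    exact ⟨hc, d, hcd, ih hd⟩

theorem HasChain.mono {k l n : ℕ} {c : α} (hkl : k ≤ l) (h : HasChain prec D l n c) :
    HasChain prec D k n c := by
  induction l, hkl using Nat.le_induction with
  | base => exact h
  | succ l _ ih => exact ih h.of_succ

theorem exists_hasChain (hne : ∀ n, (D n).Nonempty)
    (hpred : ∀ n, ∀ d ∈ D (n + 1), ∃ c ∈ D n, prec c d) (k n : ℕ) :
    ∃ c, HasChain prec D k n c := by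
  induction k generalizing n with
  | zero => exact hne n
  | succ k ih =>
    obtain ⟨d, hd⟩ := ih (n + 1)
    obtain ⟨c, hc, hcd⟩ := hpred n d hd.mem
    exact ⟨c, hc, d, hcd, hd⟩

/-- König's lemma for a sequence of nonempty finite levels in which every element has a
predecessor in the previous level. -/
theorem exists_ascending_seq (hne : ∀ n, (D n).Nonempty)
    (hpred : ∀ n, ∀ d ∈ D (n + 1), ∃ c ∈ D n, prec c d) :
    ∃ c : ℕ → α, ∀ n, c n ∈ D n ∧ prec (c n) (c (n + 1)) := by
  have hstep : ∀ n c, ∃ d, (∀ k, HasChain prec D k n c) →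
      prec c d ∧ ∀ k, HasChain prec D k (n + 1) d := by
    intro n c
    by_cases hc : ∀ k, HasChain prec D k n c
    · obtain ⟨d, -, hd⟩ := exists_mem_forall_of_antitone (D (n + 1))
        (fun k d => prec c d ∧ HasChain prec D k (n + 1) d)
        (fun k l hkl d hd => ⟨hd.1, hd.2.mono hkl⟩)
        (fun k => by
          obtain ⟨-, d, hcd, hd⟩ := hc (k + 1)
          exact ⟨d, hd.mem, hcd, hd⟩)
      exact ⟨d, fun _ => ⟨(hd 0).1, fun k => (hd k).2⟩⟩
    · exact ⟨c, fun h => absurd h hc⟩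
  choose f hf using hstep
  obtain ⟨c₀, -, hc₀⟩ := exists_mem_forall_of_antitone (D 0)
    (fun k => HasChain prec D k 0) (fun k l hkl d hd => hd.mono hkl)
    (fun k => by
      obtain ⟨c, hc⟩ := exists_hasChain hne hpred k 0
      exact ⟨c, hc.mem, hc⟩)
  let c : ℕ → α := fun n => Nat.rec c₀ (fun n x => f n x) n
  have hc : ∀ n k, HasChain prec D k n (c n) := by
    intro n
    induction n with
    | zero => exact hc₀
    | succ n ih => exact (hf n (c n) ih).2
  exact ⟨c, fun n => ⟨(hc n 0).mem, (hf n (c n) (hc n)).1⟩⟩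

/-- The lower set generated by an ascending sequence is an ideal. -/
theorem isIdeal_of_ascending_seq (htrans : Transitive prec) (c : ℕ → α)
    (hc : ∀ n, prec (c n) (c (n + 1))) : IsIdeal prec {a | ∃ n, prec a (c n)} := by
  have hmono : ∀ a n m, n ≤ m → prec a (c n) → prec a (c m) := by
    intro a n m hnm ha
    induction m, hnm using Nat.le_induction with
    | base => exact ha
    | succ m _ ih => exact htrans ih (hc m)
  refine ⟨⟨c 0, 1, hc 0⟩, fun a ⟨n, ha⟩ b hb => ⟨n, htrans hb ha⟩, ?_⟩
  rintro a ⟨n, ha⟩ b ⟨m, hb⟩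
  exact ⟨c (max n m), ⟨_, hc _⟩, hmono a n _ (le_max_left n m) ha,
    hmono b m _ (le_max_right n m) hb⟩

end HasChain

/-- The set of ideals meeting every level of a sequence of finite sets. -/
def levelSet {α : Type*} (prec : α → α → Prop) (D : ℕ → Finset α) : Set (IdealSpace prec) :=
  {J | ∀ n, ∃ c ∈ D n, c ∈ J.1}

section levelSet

variable {α : Type*} {prec : α → α → Prop} {D : ℕ → Finset α}

theorem levelSet_subset (n : ℕ) : levelSet prec D ⊆ ⋃ b ∈ D n, basicOpen prec b := by
  intro J hJ
  obtain ⟨c, hc, hcJ⟩ := hJ n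
  exact Set.mem_biUnion hc hcJ

/-- If `[b]`, `b ∈ A`, cover the level set, then some level lies above `A`. -/
theorem exists_level_above (htrans : Transitive prec)
    (hpred : ∀ n, ∀ d ∈ D (n + 1), ∃ c ∈ D n, prec c d) (A : Set α)
    (hA : levelSet prec D ⊆ ⋃ b ∈ A, basicOpen prec b) :
    ∃ n, ∀ c ∈ D n, ∃ b ∈ A, prec b c := by
  by_contra! hcon
  obtain ⟨c, hc⟩ := exists_ascending_seq (prec := prec)
    (D := fun n => (D n).filter fun c => ∀ b ∈ A, ¬ prec b c)
    (fun n => by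
      obtain ⟨c, hc, hb⟩ := hcon n
      exact ⟨c, Finset.mem_filter.2 ⟨hc, hb⟩⟩)
    (fun n d hd => by
      rw [Finset.mem_filter] at hd
      obtain ⟨c, hc, hcd⟩ := hpred n d hd.1
      exact ⟨c, Finset.mem_filter.2 ⟨hc, fun b hb hbc => hd.2 b hb (htrans hbc hcd)⟩, hcd⟩)
  let J : IdealSpace prec := ⟨_, isIdeal_of_ascending_seq htrans c fun n => (hc n).2⟩
  have hJ : J ∈ levelSet prec D :=
    fun n => ⟨c n, (Finset.mem_filter.1 (hc n).1).1, n + 1, (hc n).2⟩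
  obtain ⟨b, hb, n, hbn⟩ := Set.mem_iUnion₂.1 (hA hJ)
  exact (Finset.mem_filter.1 (hc n).1).2 b hb hbn

theorem biUnion_basicOpen_subset {S A : Set α} (h : ∀ c ∈ S, ∃ b ∈ A, prec b c) :
    (⋃ c ∈ S, basicOpen prec c) ⊆ ⋃ b ∈ A, basicOpen prec b := by
  intro J hJ
  obtain ⟨c, hc, hcJ⟩ := Set.mem_iUnion₂.1 hJ
  obtain ⟨b, hb, hbc⟩ := h c hc
  exact Set.mem_biUnion hb (J.2.2.1 c hcJ b hbc)

theorem isCompact_levelSet (htrans : Transitive prec)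
    (hpred : ∀ n, ∀ d ∈ D (n + 1), ∃ c ∈ D n, prec c d) : IsCompact (levelSet prec D) := by
  refine isCompact_generateFrom rfl fun P hP hcov => ?_
  obtain ⟨n, hn⟩ := exists_level_above htrans hpred {b | basicOpen prec b ∈ P} (by
    intro J hJ
    obtain ⟨U, hU, hJU⟩ := hcov hJ
    obtain ⟨b, rfl⟩ := hP hU
    exact Set.mem_biUnion (show b ∈ {b | basicOpen prec b ∈ P} from hU) hJU)
  choose! g hg using hn
  refine ⟨(fun c => basicOpen prec (g c)) '' (D n : Set α), ?_, (D n).finite_toSet.image _, ?_⟩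
  · rintro _ ⟨c, hc, rfl⟩
    exact (hg c hc).1
  · intro J hJ
    obtain ⟨c, hc, hcJ⟩ := hJ n
    exact ⟨_, ⟨c, hc, rfl⟩, J.2.2.1 c hcJ _ (hg c hc).2⟩

theorem levelSet_eq_sInter :
    levelSet prec D = ⋂₀ {U : Set (IdealSpace prec) | IsOpen U ∧ levelSet prec D ⊆ U} := by
  refine Set.Subset.antisymm (Set.subset_sInter fun U hU => hU.2) fun J hJ n => ?_
  have hJn := hJ _ ⟨isOpen_biUnion fun b _ => isOpen_basicOpen prec b, levelSet_subset n⟩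
  obtain ⟨c, hc, hcJ⟩ := Set.mem_iUnion₂.1 hJn
  exact ⟨c, hc, hcJ⟩

end levelSet

theorem precV_trans {prec : ℕ → ℕ → Prop} (htrans : Transitive prec) :
    Transitive (precV prec) := by
  intro r s t hrs hst F hF hFr
  have h₁ := hrs F hF hFr
  have hne : (s.support.filter fun c => ∃ b ∈ F, prec b c).Nonempty := by
    by_contra hcon
    rw [Finset.not_nonempty_iff_eq_empty] at hcon
    rw [hcon, Finset.sum_empty] at h₁
    exact not_lt_zero h₁
  refine (h₁.trans (hst _ hne (Finset.filter_subset _ _))).trans_le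
    (Finset.sum_le_sum_of_subset fun c hc => ?_)
  simp only [Finset.mem_filter] at hc ⊢
  obtain ⟨hct, d, ⟨-, b, hb, hbd⟩, hdc⟩ := hc
  exact ⟨hct, b, hb, htrans hbd hdc⟩

/-- An ideal for `≺_V` is closed under restricting the domain. -/
theorem filter_mem_of_isIdeal {prec : ℕ → ℕ → Prop} {I : Set (ℕ →₀ ℚ≥0)}
    (hI : IsIdeal (precV prec) I) {s : ℕ →₀ ℚ≥0} (hs : s ∈ I) (p : ℕ → Prop)
    [DecidablePred p] :
    s.filter p ∈ I := by
  obtain ⟨t, ht, hst, -⟩ := hI.2.2 s hs s hs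
  refine hI.2.1 t ht _ fun F hF hFs => ?_
  rw [Finsupp.support_filter] at hFs
  rw [Finset.sum_congr rfl fun b hb =>
    Finsupp.filter_apply_pos p s (Finset.mem_filter.1 (hFs hb)).2]
  exact hst F hF (hFs.trans (Finset.filter_subset _ _))

/-- In an ideal for `≺_V`, every element is below one whose domain lies above its domain. -/
theorem exists_precV_precU {prec : ℕ → ℕ → Prop} {I : Set (ℕ →₀ ℚ≥0)}
    (hI : IsIdeal (precV prec) I) {r : ℕ →₀ ℚ≥0} (hr : r ∈ I) :
    ∃ s ∈ I, precV prec r s ∧ precU prec r.support s.support := by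
  obtain ⟨s, hs, hrs, -⟩ := hI.2.2 r hr r hr
  refine ⟨s.filter fun c => ∃ b ∈ r.support, prec b c, filter_mem_of_isIdeal hI hs _, ?_, ?_⟩
  · intro F hF hFr
    refine (hrs F hF hFr).trans_eq (Finset.sum_congr ?_ fun c hc => ?_)
    · ext c
      simp only [Finsupp.support_filter, Finset.mem_filter]
      exact ⟨fun ⟨hc, b, hb, hbc⟩ => ⟨⟨hc, b, hFr hb, hbc⟩, b, hb, hbc⟩,
        fun ⟨⟨hc, _⟩, h⟩ => ⟨hc, h⟩⟩
    · rw [Finset.mem_filter, Finsupp.support_filter, Finset.mem_filter] at hc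
      exact (Finsupp.filter_apply_pos _ s hc.1.2).symm
  · intro c hc
    rw [Finsupp.support_filter, Finset.mem_filter] at hc
    exact hc.2

/-- If `I` is an ideal with respect to `≺_V` and `r ∈ I`, then there exists
a compact saturated `K ⊆ I(≺)` with `K ⊆ ⋃_{b ∈ dom r} [b]_≺`, and such that whenever
`K ⊆ ⋃_{b ∈ F} [b]_≺` for a finite `F`, there is `s ∈ I` with `r ≺_V s`, `F ≺_U dom s`
and `K ⊆ ⋃_{c ∈ dom s} [c]_≺ ⊆ ⋃_{b ∈ F} [b]_≺`. -/
theorem exists_compact_saturated (prec : ℕ → ℕ → Prop) (htrans : Transitive prec)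
    (I : Set (ℕ →₀ ℚ≥0)) (hI : IsIdeal (precV prec) I) (r : ℕ →₀ ℚ≥0) (hr : r ∈ I) :
    ∃ K : Set (IdealSpace prec),
      IsCompact K ∧
      K = ⋂₀ {U : Set (IdealSpace prec) | IsOpen U ∧ K ⊆ U} ∧
      (K ⊆ ⋃ b ∈ r.support, basicOpen prec b) ∧
      ∀ F : Finset ℕ, (K ⊆ ⋃ b ∈ F, basicOpen prec b) →
        ∃ s ∈ I, precV prec r s ∧ precU prec F s.support ∧
          (K ⊆ ⋃ c ∈ s.support, basicOpen prec c) ∧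
          ((⋃ c ∈ s.support, basicOpen prec c) ⊆ ⋃ b ∈ F, basicOpen prec b) := by
  have hstep : ∀ t, ∃ s, t ∈ I → s ∈ I ∧ precV prec t s ∧ precU prec t.support s.support := by
    intro t
    by_cases ht : t ∈ I
    · obtain ⟨s, hs⟩ := exists_precV_precU hI ht
      exact ⟨s, fun _ => hs⟩
    · exact ⟨t, fun h => absurd h ht⟩
  choose f hf using hstep
  let u : ℕ → ℕ →₀ ℚ≥0 := fun n => Nat.rec r (fun _ t => f t) n
  have hu : ∀ n, u n ∈ I := by
    intro n
    induction n with
    | zero => exact hr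
    | succ n ih => exact (hf _ ih).1
  have hru : ∀ n, precV prec r (u (n + 1)) := by
    intro n
    induction n with
    | zero => exact (hf _ hr).2.1
    | succ n ih => exact precV_trans htrans ih (hf _ (hu (n + 1))).2.1
  have hpred : ∀ n, precU prec (u n).support (u (n + 1)).support := fun n => (hf _ (hu n)).2.2
  refine ⟨levelSet prec fun n => (u n).support, isCompact_levelSet htrans hpred,
    levelSet_eq_sInter, levelSet_subset (D := fun n => (u n).support) 0, fun F hF => ?_⟩
  obtain ⟨n, hn⟩ := exists_level_above (D := fun n => (u n).support) htrans hpred (F : Set ℕ) hF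
  have hFn : precU prec F (u (n + 1)).support := by
    intro d hd
    obtain ⟨c, hc, hcd⟩ := hpred n d hd
    obtain ⟨b, hb, hbc⟩ := hn c hc
    exact ⟨b, hb, htrans hbc hcd⟩
  exact ⟨u (n + 1), hu (n + 1), hru n, hFn, levelSet_subset (D := fun n => (u n).support) (n + 1),
    biUnion_basicOpen_subset (S := ((u (n + 1)).support : Set ℕ)) (A := (F : Set ℕ)) hFn⟩
end

section
/- Let ≺ be a transitive relation on ℕ and let I be an ideal with respect to ≺_V. Define g_V(I)(U) = sup { ∑_{b∈dom(r)} r(b) : r ∈ I and ⋃_{b∈dom(r)} [b]_≺ ⊆ U } for U open in I(≺). Then g_V(I) : O(I(≺)) → [0,∞] is Scott-continuous (continuous when O(I(≺)) and [0,∞] carry their Scott topologies); in particular g_V(I) is a valuation on I(≺). -/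
open TopologicalSpace
open scoped Classical NNRat NNReal ENNReal

section

variable {prec : ℕ → ℕ → Prop} {I : Set (ℕ →₀ ℚ≥0)}

/-- The total weight that `r` assigns to a finite set. -/
noncomputable def mass (r : ℕ →₀ ℚ≥0) (F : Finset ℕ) : ℝ≥0∞ :=
  ∑ b ∈ F, ((r b : ℝ≥0) : ℝ≥0∞)

theorem mass_mono (r : ℕ →₀ ℚ≥0) {F G : Finset ℕ} (h : F ⊆ G) : mass r F ≤ mass r G :=
  Finset.sum_le_sum_of_subset h

theorem mass_union_add_mass_inter (r : ℕ →₀ ℚ≥0) (F G : Finset ℕ) :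
    mass r (F ∪ G) + mass r (F ∩ G) = mass r F + mass r G :=
  Finset.sum_union_inter

/-- The elements of `dom s` lying strictly above some element of `F`. -/
noncomputable def upIn (prec : ℕ → ℕ → Prop) (s : ℕ →₀ ℚ≥0) (F : Finset ℕ) : Finset ℕ :=
  s.support.filter fun c => ∃ b ∈ F, prec b c

theorem mem_upIn {s : ℕ →₀ ℚ≥0} {F : Finset ℕ} {c : ℕ} :
    c ∈ upIn prec s F ↔ c ∈ s.support ∧ ∃ b ∈ F, prec b c :=
  Finset.mem_filter

theorem mass_le_mass_upIn {r s : ℕ →₀ ℚ≥0} (h : precV prec r s) {F : Finset ℕ}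
    (hF : F ⊆ r.support) : mass r F ≤ mass s (upIn prec s F) := by
  rcases F.eq_empty_or_nonempty with rfl | hne
  · simp [mass]
  · have h' : ((∑ b ∈ F, r b : ℚ≥0) : ℝ≥0) ≤ ((∑ b ∈ upIn prec s F, s b : ℚ≥0) : ℝ≥0) :=
      NNRat.cast_le.2 (h F hne hF).le
    push_cast at h'
    unfold mass
    exact_mod_cast h'

theorem basicOpen_subset_of_prec {b c : ℕ} (h : prec b c) :
    basicOpen prec c ⊆ basicOpen prec b :=
  fun J hJ => J.2.2.1 c hJ b h

theorem unionOpens_le_iff {F : Finset ℕ} {U : Opens (IdealSpace prec)} :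
    unionOpens prec F ≤ U ↔ ∀ b ∈ F, basicOpens prec b ≤ U :=
  Set.iUnion₂_subset_iff

/-- The sets `[n]_≺` form a base of the topology on the space of ideals. -/
theorem exists_basicOpen_subset {U : Set (IdealSpace prec)} (hU : IsOpen U)
    {J : IdealSpace prec} (hJ : J ∈ U) : ∃ n ∈ J.1, basicOpen prec n ⊆ U := by
  induction hU with
  | basic s hs =>
    obtain ⟨n, rfl⟩ := hs
    exact ⟨n, hJ, subset_rfl⟩
  | univ =>
    obtain ⟨n, hn⟩ := J.2.1
    exact ⟨n, hn, Set.subset_univ _⟩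
  | inter s t _ _ ihs iht =>
    obtain ⟨m, hm, hms⟩ := ihs hJ.1
    obtain ⟨n, hn, hnt⟩ := iht hJ.2
    obtain ⟨c, hc, hmc, hnc⟩ := J.2.2.2 m hm n hn
    exact ⟨c, hc, Set.subset_inter ((basicOpen_subset_of_prec hmc).trans hms)
      ((basicOpen_subset_of_prec hnc).trans hnt)⟩
  | sUnion S _ ih =>
    obtain ⟨s, hs, hJs⟩ := hJ
    obtain ⟨n, hn, hns⟩ := ih s hs hJs
    exact ⟨n, hn, hns.trans (Set.subset_sUnion_of_mem hs)⟩

/-- An ideal with respect to `≺_V` is closed under restriction of the domain. -/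
theorem filter_mem (hI : IsIdeal (precV prec) I) {t : ℕ →₀ ℚ≥0} (ht : t ∈ I)
    (p : ℕ → Prop) [DecidablePred p] : t.filter p ∈ I := by
  obtain ⟨s, hs, hts, -⟩ := hI.2.2 t ht t ht
  refine hI.2.1 s hs _ fun F hne hF => ?_
  rw [Finsupp.support_filter] at hF
  have hsum : ∑ b ∈ F, t.filter p b = ∑ b ∈ F, t b :=
    Finset.sum_congr rfl fun b hb =>
      Finsupp.filter_apply_pos p t (Finset.mem_filter.1 (hF hb)).2
  rw [hsum]
  exact hts F hne (hF.trans (Finset.filter_subset _ _))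

theorem mass_le_gVfun (hI : IsIdeal (precV prec) I) {t : ℕ →₀ ℚ≥0} (ht : t ∈ I)
    {A : Finset ℕ} (hAt : A ⊆ t.support) {U : Opens (IdealSpace prec)}
    (hA : ∀ a ∈ A, basicOpens prec a ≤ U) : mass t A ≤ gVfun prec I U := by
  have hsupp : (t.filter (· ∈ A)).support = A := by
    ext a
    rw [Finsupp.support_filter, Finset.mem_filter]
    exact ⟨fun h => h.2, fun h => ⟨hAt h, h⟩⟩
  refine le_trans (le_of_eq ?_) (le_iSup₂ (t.filter (· ∈ A)) ⟨filter_mem hI ht _, ?_⟩)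
  · rw [hsupp]
    refine Finset.sum_congr rfl fun a ha => ?_
    rw [Finsupp.filter_apply_pos _ _ ha]
  · rw [hsupp]
    exact unionOpens_le_iff.2 hA

/-- The ideal generated by an increasing sequence. -/
theorem isIdeal_of_chain [IsTrans ℕ prec] {b : ℕ → ℕ}
    (hb : ∀ n, prec (b n) (b (n + 1))) : IsIdeal prec {x | ∃ n, prec x (b n)} := by
  have hlt : ∀ {m n}, m < n → prec (b m) (b n) := fun h =>
    Nat.rel_of_forall_rel_succ_of_lt prec hb h
  refine ⟨⟨b 0, 1, hb 0⟩, fun a ⟨n, hn⟩ c hc => ⟨n, trans_of prec hc hn⟩, ?_⟩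
  rintro x ⟨m, hm⟩ y ⟨n, hn⟩
  exact ⟨b (m + n + 1), ⟨_, hb _⟩, trans_of prec hm (hlt (by omega)), trans_of prec hn (hlt (by omega))⟩

/-- `Reach prec r n j b c` says that `c` is reached from `b` by an increasing path of length `n`
through `dom (r (j + 1))`, `dom (r (j + 2))`, … -/
def Reach (prec : ℕ → ℕ → Prop) (r : ℕ → ℕ →₀ ℚ≥0) : ℕ → ℕ → ℕ → ℕ → Prop
  | 0, _, b, c => c = b
  | n + 1, j, b, c => ∃ b' ∈ (r (j + 1)).support, prec b b' ∧ Reach prec r n (j + 1) b' c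

theorem Reach.mem_of_mem {r : ℕ → ℕ →₀ ℚ≥0} {C : Set ℕ}
    (hC : ∀ b ∈ C, ∀ c, prec b c → c ∈ C) {n j b c : ℕ} (hb : b ∈ C)
    (h : Reach prec r n j b c) : c ∈ C := by
  induction n generalizing j b with
  | zero => exact (show c = b from h) ▸ hb
  | succ n ih =>
    obtain ⟨b', -, hbb', h'⟩ := h
    exact ih (hC b hb b' hbb') h'

theorem mass_le_mass_reach {r : ℕ → ℕ →₀ ℚ≥0} (hr : ∀ n, precV prec (r n) (r (n + 1)))
    (n j : ℕ) {F : Finset ℕ} (hF : F ⊆ (r j).support) :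
    mass (r j) F ≤
      mass (r (j + n)) ((r (j + n)).support.filter fun c => ∃ b ∈ F, Reach prec r n j b c) := by
  induction n generalizing j F with
  | zero => exact mass_mono _ fun b hb => Finset.mem_filter.2 ⟨hF hb, b, hb, rfl⟩
  | succ n ih =>
    have key := (mass_le_mass_upIn (hr j) hF).trans
      (ih (j + 1) (F := upIn prec (r (j + 1)) F) (Finset.filter_subset _ _))
    rw [Nat.add_right_comm, Nat.add_assoc] at key
    refine key.trans (mass_mono _ fun c hc => ?_)
    obtain ⟨hc, b', hb', h⟩ := Finset.mem_filter.1 hc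
    obtain ⟨hb's, b, hb, hbb'⟩ := mem_upIn.1 hb'
    exact Finset.mem_filter.2 ⟨hc, b, hb, b', hb's, hbb', h⟩

/-- One step of an increasing path through the domains of `r` that starts outside `C`. -/
def AvoidStep (prec : ℕ → ℕ → Prop) (r : ℕ → ℕ →₀ ℚ≥0) (C : Set ℕ) (q p : ℕ × ℕ) : Prop :=
  q.1 = p.1 + 1 ∧ q.2 ∈ (r q.1).support ∧ prec p.2 q.2 ∧ p.2 ∉ C

theorem acc_avoidStep [IsTrans ℕ prec] (r : ℕ → ℕ →₀ ℚ≥0) {C : Set ℕ}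
    (hC : ∀ b ∈ C, ∀ c, prec b c → c ∈ C) {j b : ℕ}
    (hb : ∀ J : IdealSpace prec, b ∈ J.1 → ∃ n ∈ J.1, n ∈ C) :
    Acc (AvoidStep prec r C) (j, b) := by
  by_contra hacc
  obtain ⟨f, hf0, hf⟩ := not_acc_iff_exists_descending_chain.1 hacc
  have hchain : ∀ n, prec (f n).2 (f (n + 1)).2 := fun n => (hf n).2.2.1
  obtain ⟨m, ⟨n, hmn⟩, hm⟩ := hb ⟨_, isIdeal_of_chain hchain⟩
    ⟨1, by simpa only [hf0] using hchain 0⟩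
  exact (hf n).2.2.2 (hC m hm _ hmn)

theorem eventually_reach_mem {r : ℕ → ℕ →₀ ℚ≥0} {C : Set ℕ}
    (hC : ∀ b ∈ C, ∀ c, prec b c → c ∈ C) {p : ℕ × ℕ} (hp : Acc (AvoidStep prec r C) p) :
    ∀ᶠ n in Filter.atTop, ∀ c, Reach prec r n p.1 p.2 c → c ∈ C := by
  induction hp with
  | intro p _ ih =>
    by_cases hpC : p.2 ∈ C
    · exact Filter.Eventually.of_forall fun n c h => h.mem_of_mem hC hpC
    have hsucc : ∀ᶠ n in Filter.atTop, ∀ b ∈ upIn prec (r (p.1 + 1)) {p.2},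
        ∀ c, Reach prec r n (p.1 + 1) b c → c ∈ C := by
      rw [Filter.eventually_all_finset]
      intro b hb
      obtain ⟨hbs, b', hb', hprec⟩ := mem_upIn.1 hb
      rw [Finset.mem_singleton.1 hb'] at hprec
      exact ih (p.1 + 1, b) ⟨rfl, hbs, hprec, hpC⟩
    rw [← Filter.map_add_atTop_eq_nat 1, Filter.eventually_map]
    filter_upwards [hsucc] with n hn c ⟨b, hbs, hprec, h⟩
    exact hn b (mem_upIn.2 ⟨hbs, p.2, Finset.mem_singleton_self _, hprec⟩) c h

/-- If every ideal meeting `dom r` meets the upper set `C`, then the weight of `r` is dominated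
by that of an element of `I` whose domain lies in `C`. -/
theorem exists_mass_le_of_bar [IsTrans ℕ prec] (hI : IsIdeal (precV prec) I)
    {C : Set ℕ} (hC : ∀ b ∈ C, ∀ c, prec b c → c ∈ C) {r : ℕ →₀ ℚ≥0} (hr : r ∈ I)
    (hbar : ∀ b ∈ r.support, ∀ J : IdealSpace prec, b ∈ J.1 → ∃ n ∈ J.1, n ∈ C) :
    ∃ s ∈ I, ∃ A ⊆ s.support, (∀ a ∈ A, a ∈ C) ∧ mass r r.support ≤ mass s A := by
  have hstep : ∀ s : I, ∃ t : I, precV prec s.1 t.1 := fun s =>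
    let ⟨t, ht, hst, _⟩ := hI.2.2 s.1 s.2 s.1 s.2
    ⟨⟨t, ht⟩, hst⟩
  choose succ hsucc using hstep
  let u : ℕ → I := fun n => succ^[n] ⟨r, hr⟩
  have hu : ∀ n, precV prec (u n).1 (u (n + 1)).1 := fun n => by
    simp only [u, Function.iterate_succ_apply']
    exact hsucc _
  have hev : ∀ᶠ n in Filter.atTop, ∀ b ∈ r.support,
      ∀ c, Reach prec (fun n => (u n).1) n 0 b c → c ∈ C := by
    rw [Filter.eventually_all_finset]
    exact fun b hb =>
      eventually_reach_mem hC (acc_avoidStep _ hC (j := 0) (hbar b hb))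
  obtain ⟨n, hn⟩ := hev.exists
  refine ⟨_, (u (0 + n)).2, _, Finset.filter_subset _ _, fun c hc => ?_,
    mass_le_mass_reach (r := fun n => (u n).1) hu n 0 (F := r.support) (subset_refl r.support)⟩
  obtain ⟨-, b, hb, h⟩ := Finset.mem_filter.1 hc
  exact hn b hb c h

theorem nonempty_unionOpens_support [IsTrans ℕ prec] (hI : IsIdeal (precV prec) I)
    {r : ℕ →₀ ℚ≥0} (hr : r ∈ I) (h : r.support.Nonempty) :
    (unionOpens prec r.support : Set (IdealSpace prec)).Nonempty := by
  by_contra hempty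
  rw [Set.not_nonempty_iff_eq_empty] at hempty
  have hbar : ∀ b ∈ r.support, ∀ J : IdealSpace prec, b ∈ J.1 → ∃ n ∈ J.1, n ∈ (∅ : Set ℕ) :=
    fun b hb J hJ => absurd (Set.mem_biUnion (s := (r.support : Set ℕ)) hb hJ)
      (Set.eq_empty_iff_forall_notMem.1 hempty J)
  obtain ⟨s, -, A, -, hA, hle⟩ := exists_mass_le_of_bar hI (by simp) hr hbar
  obtain rfl : A = ∅ := Finset.eq_empty_of_forall_notMem hA
  obtain ⟨b, hb⟩ := h
  have hzero : mass r r.support = 0 := by simpa [mass] using hle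
  have := Finset.sum_eq_zero_iff.1 hzero b hb
  exact Finsupp.mem_support_iff.1 hb (by exact_mod_cast this)

theorem gVfun_mono : Monotone (gVfun prec I) := fun _ _ hUV =>
  biSup_mono fun _ hr => ⟨hr.1, hr.2.trans hUV⟩

theorem gVfun_le_iff {U : Opens (IdealSpace prec)} {z : ℝ≥0∞} :
    gVfun prec I U ≤ z ↔
      ∀ r ∈ I, (∀ b ∈ r.support, basicOpens prec b ≤ U) → mass r r.support ≤ z := by
  simp only [gVfun, iSup₂_le_iff, Set.mem_ofPred_eq, unionOpens_le_iff, and_imp, mass]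

theorem gVfun_add_le {U V : Opens (IdealSpace prec)} {z : ℝ≥0∞} (hI : IsIdeal (precV prec) I)
    (h : ∀ r ∈ I, ∀ s ∈ I, (∀ b ∈ r.support, basicOpens prec b ≤ U) →
      (∀ b ∈ s.support, basicOpens prec b ≤ V) →
        mass r r.support + mass s s.support ≤ z) :
    gVfun prec I U + gVfun prec I V ≤ z := by
  obtain ⟨t, ht⟩ := hI.1
  have h0 : (0 : ℕ →₀ ℚ≥0) ∈ I := by
    refine hI.2.1 t ht 0 fun F hne hF => absurd hne ?_
    simpa using hF
  refine ENNReal.biSup_add_biSup_le' (f := fun r : ℕ →₀ ℚ≥0 => mass r r.support)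
    (g := fun r : ℕ →₀ ℚ≥0 => mass r r.support)
    ⟨0, h0, unionOpens_le_iff.2 (by simp)⟩ ⟨0, h0, unionOpens_le_iff.2 (by simp)⟩ ?_
  exact fun r hr s hs =>
    h r hr.1 s hs.1 (unionOpens_le_iff.1 hr.2) (unionOpens_le_iff.1 hs.2)

theorem basicOpens_le_of_mem_upIn {t : ℕ →₀ ℚ≥0} {F : Finset ℕ} {U : Opens (IdealSpace prec)}
    (hF : ∀ b ∈ F, basicOpens prec b ≤ U) {c : ℕ} (hc : c ∈ upIn prec t F) :
    basicOpens prec c ≤ U := by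
  obtain ⟨-, b, hb, hbc⟩ := mem_upIn.1 hc
  exact le_trans (basicOpen_subset_of_prec hbc) (hF b hb)

theorem scottContinuous_gVfun [IsTrans ℕ prec] (hI : IsIdeal (precV prec) I) :
    ScottContinuous (gVfun prec I) := by
  intro d hne hdir a ha
  refine ⟨gVfun_mono.mem_upperBounds_image ha.1, fun z hz => gVfun_le_iff.2 fun r hr hrU => ?_⟩
  obtain rfl := ha.sSup_eq
  obtain ⟨s, hs, A, hAs, hAC, hle⟩ := exists_mass_le_of_bar hI
    (C := {n | ∃ U ∈ d, basicOpens prec n ≤ U})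
    (fun b ⟨U, hU, hb⟩ c hbc => ⟨U, hU, le_trans (basicOpen_subset_of_prec hbc) hb⟩) hr
    (fun b hb J hJ => by
      obtain ⟨U, hU, hJU⟩ := Opens.mem_sSup.1 (hrU b hb hJ)
      obtain ⟨n, hn, hnU⟩ := exists_basicOpen_subset U.2 hJU
      exact ⟨n, hn, U, hU, hnU⟩)
  have hfin : ∃ U ∈ d, ∀ n ∈ A, basicOpens prec n ≤ U := by
    clear hle hAs
    induction A using Finset.induction_on with
    | empty =>
      obtain ⟨U, hU⟩ := hne
      exact ⟨U, hU, by simp⟩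
    | insert n A _ ih =>
      obtain ⟨U, hU, hAU⟩ := ih fun a ha => hAC a (Finset.mem_insert_of_mem ha)
      obtain ⟨V, hV, hnV⟩ := hAC n (Finset.mem_insert_self n A)
      obtain ⟨W, hW, hUW, hVW⟩ := hdir U hU V hV
      refine ⟨W, hW, fun m hm => ?_⟩
      rcases Finset.mem_insert.1 hm with rfl | hm
      · exact hnV.trans hVW
      · exact (hAU m hm).trans hUW
  obtain ⟨U, hU, hAU⟩ := hfin
  exact hle.trans ((mass_le_gVfun hI hs hAs hAU).trans (hz ⟨U, hU, rfl⟩))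

theorem gVfun_bot [IsTrans ℕ prec] (hI : IsIdeal (precV prec) I) :
    gVfun prec I ⊥ = 0 := by
  refine le_antisymm (gVfun_le_iff.2 fun r hr hrU => ?_) bot_le
  rcases r.support.eq_empty_or_nonempty with h | h
  · simp [h, mass]
  · obtain ⟨J, hJ⟩ := nonempty_unionOpens_support hI hr h
    exact (unionOpens_le_iff.2 hrU hJ).elim

theorem gVfun_add_le_sup_add_inf (hI : IsIdeal (precV prec) I)
    (U V : Opens (IdealSpace prec)) :
    gVfun prec I U + gVfun prec I V ≤ gVfun prec I (U ⊔ V) + gVfun prec I (U ⊓ V) := by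
  refine gVfun_add_le hI fun r hr s hs hrU hsV => ?_
  obtain ⟨t, ht, hrt, hst⟩ := hI.2.2 r hr s hs
  have hA : upIn prec t r.support ⊆ t.support := Finset.filter_subset _ _
  have hB : upIn prec t s.support ⊆ t.support := Finset.filter_subset _ _
  calc mass r r.support + mass s s.support
      ≤ mass t (upIn prec t r.support) + mass t (upIn prec t s.support) :=
        add_le_add (mass_le_mass_upIn hrt subset_rfl) (mass_le_mass_upIn hst subset_rfl)
    _ = mass t (upIn prec t r.support ∪ upIn prec t s.support) +
          mass t (upIn prec t r.support ∩ upIn prec t s.support) :=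
        (mass_union_add_mass_inter _ _ _).symm
    _ ≤ _ := by
      refine add_le_add
        (mass_le_gVfun hI ht (Finset.union_subset hA hB) fun c hc => ?_)
        (mass_le_gVfun hI ht (Finset.inter_subset_left.trans hA) fun c hc => ?_)
      · rcases Finset.mem_union.1 hc with hc | hc
        · exact (basicOpens_le_of_mem_upIn hrU hc).trans le_sup_left
        · exact (basicOpens_le_of_mem_upIn hsV hc).trans le_sup_right
      · rw [Finset.mem_inter] at hc
        exact le_inf (basicOpens_le_of_mem_upIn hrU hc.1) (basicOpens_le_of_mem_upIn hsV hc.2)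

theorem gVfun_sup_add_inf_le [IsTrans ℕ prec] (hI : IsIdeal (precV prec) I)
    (U V : Opens (IdealSpace prec)) :
    gVfun prec I (U ⊔ V) + gVfun prec I (U ⊓ V) ≤ gVfun prec I U + gVfun prec I V := by
  refine gVfun_add_le hI fun r hr s hs hrUV hsUV => ?_
  obtain ⟨r', hr', A, hAr', hAC, hle⟩ := exists_mass_le_of_bar hI
    (C := {n | basicOpens prec n ≤ U ∨ basicOpens prec n ≤ V})
    (fun b hb c hbc => hb.imp (le_trans (basicOpen_subset_of_prec hbc))
      (le_trans (basicOpen_subset_of_prec hbc))) hr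
    (fun b hb J hJ => by
      rcases hrUV b hb hJ with hJU | hJV
      · obtain ⟨n, hn, hnU⟩ := exists_basicOpen_subset U.2 hJU
        exact ⟨n, hn, Or.inl hnU⟩
      · obtain ⟨n, hn, hnV⟩ := exists_basicOpen_subset V.2 hJV
        exact ⟨n, hn, Or.inr hnV⟩)
  obtain ⟨t, ht, hrt, hst⟩ := hI.2.2 r' hr' s hs
  let DU := t.support.filter fun c => basicOpens prec c ≤ U
  let DV := t.support.filter fun c => basicOpens prec c ≤ V
  have hA : upIn prec t A ⊆ DU ∪ DV := fun c hc => by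
    obtain ⟨hct, b, hb, hbc⟩ := mem_upIn.1 hc
    exact Finset.mem_union.2 ((hAC b hb).imp
      (fun h => Finset.mem_filter.2 ⟨hct, le_trans (basicOpen_subset_of_prec hbc) h⟩)
      (fun h => Finset.mem_filter.2 ⟨hct, le_trans (basicOpen_subset_of_prec hbc) h⟩))
  have hB : upIn prec t s.support ⊆ DU ∩ DV := fun c hc => by
    have hct := (mem_upIn.1 hc).1
    have hcUV := le_inf_iff.1 (basicOpens_le_of_mem_upIn hsUV hc)
    exact Finset.mem_inter.2
      ⟨Finset.mem_filter.2 ⟨hct, hcUV.1⟩, Finset.mem_filter.2 ⟨hct, hcUV.2⟩⟩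
  calc mass r r.support + mass s s.support
      ≤ mass t (upIn prec t A) + mass t (upIn prec t s.support) :=
        add_le_add (hle.trans (mass_le_mass_upIn hrt hAr')) (mass_le_mass_upIn hst subset_rfl)
    _ ≤ mass t (DU ∪ DV) + mass t (DU ∩ DV) := add_le_add (mass_mono t hA) (mass_mono t hB)
    _ = mass t DU + mass t DV := mass_union_add_mass_inter _ _ _
    _ ≤ _ := add_le_add
        (mass_le_gVfun hI ht (Finset.filter_subset _ _) fun _ hc => (Finset.mem_filter.1 hc).2)
        (mass_le_gVfun hI ht (Finset.filter_subset _ _) fun _ hc => (Finset.mem_filter.1 hc).2)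

end

/-- For an ideal `I` with respect to `≺_V`, the function
`g_V(I) : O(I(≺)) → [0,∞]` is Scott-continuous; in particular it is a valuation
(also strict and modular). -/
theorem gVfun_scottContinuous (prec : ℕ → ℕ → Prop) (htrans : Transitive prec)
    (I : Set (ℕ →₀ ℚ≥0)) (hI : IsIdeal (precV prec) I) :
    ScottContinuous (gVfun prec I) ∧
      gVfun prec I ⊥ = 0 ∧
      ∀ U V : Opens (IdealSpace prec),
        gVfun prec I U + gVfun prec I V = gVfun prec I (U ⊔ V) + gVfun prec I (U ⊓ V) := by
  have : IsTrans ℕ prec := ⟨fun _ _ _ => @htrans _ _ _⟩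
  exact ⟨scottContinuous_gVfun hI, gVfun_bot hI, fun U V =>
    le_antisymm (gVfun_add_le_sup_add_inf hI U V) (gVfun_sup_add_inf_le hI U V)⟩
end

section
/- Let ≺ be a transitive relation on ℕ, let I be an ideal with respect to ≺_V, let U be an open subset of I(≺), and let A ⊆ ℕ satisfy U = ⋃_{a∈A} [a]_≺. Then g_V(I)(U) = sup { ∑_{c∈dom(s)} s(c) : s ∈ I and for every c ∈ dom(s) there exists a ∈ A with a ≺ c }, where g_V(I)(U) = sup { ∑_{b∈dom(r)} r(b) : r ∈ I and ⋃_{b∈dom(r)} [b]_≺ ⊆ U }. -/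
open TopologicalSpace
open scoped Classical NNRat NNReal ENNReal

/-- `EndsAbove prec A s k n c`: every chain `c ≺ c₁ ≺ ⋯ ≺ cₖ` with `cᵢ ∈ dom (s (n + i))`
ends above an element of `A`. -/
def EndsAbove (prec : ℕ → ℕ → Prop) (A : Set ℕ) (s : ℕ → ℕ →₀ ℚ≥0) : ℕ → ℕ → ℕ → Prop
  | 0, _, c => ∃ a ∈ A, prec a c
  | k + 1, n, c => ∀ d ∈ (s (n + 1)).support, prec c d → EndsAbove prec A s k (n + 1) d

theorem EndsAbove.succ {prec : ℕ → ℕ → Prop} (htrans : Transitive prec) {A : Set ℕ}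
    {s : ℕ → ℕ →₀ ℚ≥0} {k n c : ℕ} (h : EndsAbove prec A s k n c) :
    EndsAbove prec A s (k + 1) n c := by
  induction k generalizing n c with
  | zero =>
    obtain ⟨a, ha, hac⟩ := h
    exact fun d _ hcd => ⟨a, ha, htrans hac hcd⟩
  | succ k ih => exact fun d hd hcd => ih (h d hd hcd)

theorem EndsAbove.mono {prec : ℕ → ℕ → Prop} (htrans : Transitive prec) {A : Set ℕ}
    {s : ℕ → ℕ →₀ ℚ≥0} {k l n c : ℕ} (hkl : k ≤ l) (h : EndsAbove prec A s k n c) :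
    EndsAbove prec A s l n c := by
  induction l, hkl using Nat.le_induction with
  | base => exact h
  | succ l _ ih => exact ih.succ htrans

theorem exists_uniform_endsAbove {prec : ℕ → ℕ → Prop} (htrans : Transitive prec) {A : Set ℕ}
    {s : ℕ → ℕ →₀ ℚ≥0} {n : ℕ} (F : Finset ℕ) (h : ∀ c ∈ F, ∃ k, EndsAbove prec A s k n c) :
    ∃ k, ∀ c ∈ F, EndsAbove prec A s k n c := by
  choose! f hf using h
  exact ⟨F.sup f, fun c hc => (hf c hc).mono htrans (Finset.le_sup hc)⟩

/-- The lower set generated by an ascending chain is an ideal. -/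
theorem isIdeal_of_chain_s19 {α : Type*} {prec : α → α → Prop} (htrans : Transitive prec)
    {c : ℕ → α} (hc : ∀ n, prec (c n) (c (n + 1))) : IsIdeal prec {x | ∃ n, prec x (c n)} := by
  have hmono : ∀ x m n, m ≤ n → prec x (c m) → prec x (c n) := fun x m n hmn hx => by
    induction n, hmn using Nat.le_induction with
    | base => exact hx
    | succ n _ ih => exact htrans ih (hc n)
  refine ⟨⟨c 0, 1, hc 0⟩, ?_, ?_⟩
  · rintro a ⟨n, hn⟩ b hb
    exact ⟨n, htrans hb hn⟩
  · rintro a ⟨m, hm⟩ b ⟨n, hn⟩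
    exact ⟨c (max m n), ⟨_, hc _⟩, hmono a m _ (le_max_left m n) hm,
      hmono b n _ (le_max_right m n) hn⟩

/-- If `[b] ⊆ ⋃_{a ∈ A} [a]`, then all sufficiently long chains starting at `b` and running
through finite levels end above an element of `A`, by König's lemma. -/
theorem exists_endsAbove_of_basicOpen_subset {prec : ℕ → ℕ → Prop} (htrans : Transitive prec)
    {A : Set ℕ} (s : ℕ → ℕ →₀ ℚ≥0) {b : ℕ}
    (hb : basicOpen prec b ⊆ ⋃ a ∈ A, basicOpen prec a) :
    ∃ k, EndsAbove prec A s k 0 b := by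
  by_contra hbad
  have hstep : ∀ n (c : {c // ¬ ∃ k, EndsAbove prec A s k n c}),
      ∃ d : {d // ¬ ∃ k, EndsAbove prec A s k (n + 1) d}, prec c.1 d.1 := by
    rintro n ⟨c, hc⟩
    by_contra! hd
    obtain ⟨k, hk⟩ := exists_uniform_endsAbove (A := A) (s := s) (n := n + 1) htrans
      ((s (n + 1)).support.filter (prec c)) fun d hdF => by
        by_contra hdbad
        exact hd ⟨d, hdbad⟩ (Finset.mem_filter.1 hdF).2
    exact hc ⟨k + 1, fun d hds hcd => hk d (Finset.mem_filter.2 ⟨hds, hcd⟩)⟩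
  choose f hf using hstep
  let c : ∀ n, {c // ¬ ∃ k, EndsAbove prec A s k n c} := fun n => Nat.rec ⟨b, hbad⟩ f n
  have hc : ∀ n, prec (c n).1 (c (n + 1)).1 := fun n => hf n (c n)
  have hmem := hb (a := ⟨_, isIdeal_of_chain_s19 htrans hc⟩) (show ∃ n, prec b (c n).1 from ⟨1, hc 0⟩)
  obtain ⟨a, ha, n, hn⟩ := Set.mem_iUnion₂.1 hmem
  exact (c n).2 ⟨0, a, ha, hn⟩

theorem exists_sum_le_of_endsAbove {prec : ℕ → ℕ → Prop} {A : Set ℕ} {s : ℕ → ℕ →₀ ℚ≥0}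
    (hs : ∀ n, precV prec (s n) (s (n + 1))) {k n : ℕ} {F : Finset ℕ} (hF : F ⊆ (s n).support)
    (h : ∀ c ∈ F, EndsAbove prec A s k n c) :
    ∃ N, ∃ G ⊆ (s N).support, (∀ c ∈ G, ∃ a ∈ A, prec a c) ∧
      ∑ b ∈ F, s n b ≤ ∑ c ∈ G, s N c := by
  induction k generalizing n F with
  | zero => exact ⟨n, F, hF, h, le_rfl⟩
  | succ k ih =>
    obtain rfl | hne := F.eq_empty_or_nonempty
    · exact ⟨n, ∅, by simp, by simp, le_rfl⟩
    obtain ⟨N, G, hG, hGA, hle⟩ := ih (n := n + 1)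
      (F := (s (n + 1)).support.filter fun c => ∃ b ∈ F, prec b c)
      (Finset.filter_subset _ _) fun d hd => by
        obtain ⟨hds, b, hbF, hbd⟩ := Finset.mem_filter.1 hd
        exact h b hbF d hds hbd
    exact ⟨N, G, hG, hGA, (hs n F hne hF).le.trans hle⟩

theorem IsIdeal.exists_chain {α : Type*} {prec : α → α → Prop} {I : Set α} (hI : IsIdeal prec I)
    {r : α} (hr : r ∈ I) :
    ∃ s : ℕ → α, s 0 = r ∧ (∀ n, s n ∈ I) ∧ ∀ n, prec (s n) (s (n + 1)) := by
  have hstep : ∀ x : I, ∃ y : I, prec x.1 y.1 := fun x => by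
    obtain ⟨y, hy, hxy, -⟩ := hI.2.2 x x.2 x x.2
    exact ⟨⟨y, hy⟩, hxy⟩
  choose f hf using hstep
  let s : ℕ → I := fun n => Nat.rec ⟨r, hr⟩ (fun _ => f) n
  exact ⟨fun n => (s n).1, rfl, fun n => (s n).2, fun n => hf (s n)⟩

theorem precV.filter {prec : ℕ → ℕ → Prop} {r s : ℕ →₀ ℚ≥0} (h : precV prec r s)
    (p : ℕ → Prop) [DecidablePred p] : precV prec (r.filter p) s := by
  intro F hne hF
  have hp : ∀ b ∈ F, p b ∧ b ∈ r.support := fun b hb => by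
    have := hF hb
    rw [Finsupp.support_filter, Finset.mem_filter] at this
    exact this.symm
  rw [Finset.sum_congr rfl fun b hb => Finsupp.filter_apply_pos p r (hp b hb).1]
  exact h F hne fun b hb => (hp b hb).2

/-- If `I` is an ideal with respect to `≺_V`, `U` is open in `I(≺)`, and
`A ⊆ ℕ` satisfies `U = ⋃_{a ∈ A} [a]_≺`, then
`g_V(I)(U) = ⨆ {∑_{c ∈ dom s} s c | s ∈ I and ∀ c ∈ dom s, ∃ a ∈ A, a ≺ c}`. -/
theorem gVfun_eq_sup (prec : ℕ → ℕ → Prop) (htrans : Transitive prec)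
    (I : Set (ℕ →₀ ℚ≥0)) (hI : IsIdeal (precV prec) I)
    (U : Opens (IdealSpace prec)) (A : Set ℕ)
    (hU : (U : Set (IdealSpace prec)) = ⋃ a ∈ A, basicOpen prec a) :
    gVfun prec I U =
      ⨆ s ∈ {s : ℕ →₀ ℚ≥0 | s ∈ I ∧ ∀ c ∈ s.support, ∃ a ∈ A, prec a c},
        ∑ c ∈ s.support, ((s c : ℝ≥0) : ℝ≥0∞) := by
  apply le_antisymm
  · refine iSup₂_le fun r ⟨hr, hrU⟩ => ?_
    obtain ⟨s, rfl, hsI, hs⟩ := hI.exists_chain hr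
    obtain ⟨k, hk⟩ := exists_uniform_endsAbove (A := A) (s := s) (n := 0) htrans (s 0).support
      fun b hb => exists_endsAbove_of_basicOpen_subset htrans s <| hU ▸
        (Set.subset_biUnion_of_mem (u := fun b => basicOpen prec b) hb).trans hrU
    obtain ⟨N, G, hG, hGA, hle⟩ := exists_sum_le_of_endsAbove hs subset_rfl hk
    have hsupp : ((s N).filter (· ∈ G)).support = G := by
      rw [Finsupp.support_filter]
      ext c
      rw [Finset.mem_filter]
      exact ⟨And.right, fun hc => ⟨hG hc, hc⟩⟩
    have hmem : (s N).filter (· ∈ G) ∈ I :=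
      hI.2.1 (s (N + 1)) (hsI (N + 1)) _ ((hs N).filter (· ∈ G))
    refine le_iSup₂_of_le ((s N).filter (· ∈ G)) ⟨hmem, by rwa [hsupp]⟩ ?_
    have hfilter : ∑ c ∈ G, (s N).filter (· ∈ G) c = ∑ c ∈ G, s N c :=
      Finset.sum_congr rfl fun c hc => Finsupp.filter_apply_pos (· ∈ G) (s N) hc
    rw [hsupp]
    rw [← hfilter] at hle
    exact_mod_cast hle
  · refine iSup₂_le fun s ⟨hs, hsA⟩ => le_iSup₂_of_le s ⟨hs, ?_⟩ le_rfl
    change (⋃ b ∈ s.support, basicOpen prec b) ⊆ (U : Set (IdealSpace prec))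
    rw [hU]
    refine Set.iUnion₂_subset fun c hc J hJ => ?_
    obtain ⟨a, ha, hac⟩ := hsA c hc
    exact Set.mem_biUnion ha (J.2.2.1 c hJ a hac)
end
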